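/- arXiv:1112.5512 — 2 statements merged into one kernel-verified Lean document; each statement's English description precedes it below -/
import Mathlib

section
/- The intersection number K_{Mbar_{0,12}} · C_𝒫 equals 13 and in particular is nonnegative; concretely, with k : Finset X → ℤ defined by k(T) = −1 if |T| = 1 or |T| = 11 and k(T) = −2 otherwise, the sum over all subsets T ⊆ X with ∅ ≠ T ≠ X of k(T)·c(T) equals 26 (each unordered class {T, X∖T} is counted twice). -/
open Finset

/-- The nonzero quadratic residues modulo 11. -/
def Q : Finset (ZMod 11) := {1, 3, 4, 5, 9}

/-- The (11,5,2) biplane: the family of the eleven translates `Q + t` of `Q`. -/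
def biplane : Finset (Finset (ZMod 11)) :=
  (Finset.univ : Finset (ZMod 11)).image fun t => Q.image (· + t)

/-- The 12-element index type of marked points of `Mbar_{0,12}`;
`none` is the 12th marked point. -/
abbrev X : Type := Option (ZMod 11)

/-- For `B ⊆ ZMod 11`, the subset `B* = {some b : b ∈ B}` of `X`. -/
def bstar (B : Finset (ZMod 11)) : Finset X := B.image some

open Classical in
/-- The pairing of the curve class `C_𝒫` with the divisor generator `Δ_T`. -/
noncomputable def cP : Finset X → ℤ := fun T =>
  if ∃ B ∈ biplane, T = bstar B ∨ T = (bstar B)ᶜ then 1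
  else if ∃ k : ZMod 11, T = {some k} ∨ T = ({some k} : Finset X)ᶜ then -3
  else if T = {none} ∨ T = ({none} : Finset X)ᶜ then -2
  else 0

/-- The coefficient function of the canonical divisor `K_{Mbar_{0,12}}`. -/
def kK : Finset X → ℤ := fun T =>
  if T.card = 1 ∨ T.card = 11 then -1 else -2

/-- The family `F` together with the complements of its members. -/
def withCompl (F : Finset (Finset X)) : Finset (Finset X) := F ∪ F.image compl

lemma mem_withCompl {F : Finset (Finset X)} {T : Finset X} :
    T ∈ withCompl F ↔ ∃ A ∈ F, T = A ∨ T = Aᶜ := by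
  simp only [withCompl, mem_union, mem_image]
  grind

lemma card_compl_X (A : Finset X) : Aᶜ.card = 12 - A.card := by
  rw [card_compl]
  rfl

lemma card_of_mem_withCompl {F : Finset (Finset X)} {a : ℕ} (hF : ∀ A ∈ F, A.card = a)
    {T : Finset X} (hT : T ∈ withCompl F) : T.card = a ∨ T.card = 12 - a := by
  obtain ⟨A, hA, rfl | rfl⟩ := mem_withCompl.1 hT
  · exact .inl (hF _ hA)
  · exact .inr (by rw [card_compl_X, hF A hA])

lemma card_withCompl {F : Finset (Finset X)} {a : ℕ} (hF : ∀ A ∈ F, A.card = a) (ha : a < 6) :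
    (withCompl F).card = 2 * F.card := by
  rw [withCompl, card_union_of_disjoint, card_image_of_injective _ compl_injective, two_mul]
  rw [disjoint_left]
  intro A hA hA'
  obtain ⟨B, hB, rfl⟩ := mem_image.1 hA'
  have := card_compl_X B
  rw [hF _ hA, hF B hB] at this
  omega

/-- The members of `withCompl F` are proper and nonempty. -/
lemma withCompl_subset_proper {F : Finset (Finset X)} {a : ℕ} (hF : ∀ A ∈ F, A.card = a)
    (ha : 0 < a) (ha' : a < 6) :
    withCompl F ⊆ Finset.univ.filter (fun T : Finset X => T ≠ ∅ ∧ T ≠ Finset.univ) := by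
  intro T hT
  have h := card_of_mem_withCompl hF hT
  refine mem_filter.2 ⟨mem_univ _, ?_, ?_⟩
  · rintro rfl
    rw [card_empty] at h
    omega
  · rintro rfl
    rw [show (Finset.univ : Finset X).card = 12 from rfl] at h
    omega

lemma sum_withCompl {F : Finset (Finset X)} {a : ℕ} (hF : ∀ A ∈ F, A.card = a)
    (ha : 0 < a) (ha' : a < 6) (z : ℤ) :
    ∑ T ∈ Finset.univ.filter (fun T : Finset X => T ≠ ∅ ∧ T ≠ Finset.univ),
      (if T ∈ withCompl F then z else 0) = 2 * F.card * z := by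
  rw [sum_ite_mem, inter_eq_right.2 (withCompl_subset_proper hF ha ha'), sum_const,
    card_withCompl hF ha', nsmul_eq_mul]
  push_cast
  rfl

/-- The blocks of the biplane, as subsets of `X`. -/
def blocks : Finset (Finset X) := biplane.image bstar

/-- The singletons of the marked points other than `none`. -/
def points : Finset (Finset X) := Finset.univ.image fun k : ZMod 11 => {some k}

lemma card_biplane : biplane.card = 11 := by decide

lemma card_blocks : blocks.card = 11 := by
  have h : Function.Injective bstar := image_injective (Option.some_injective _)
  rw [blocks, card_image_of_injective _ h, card_biplane]

lemma card_of_mem_blocks : ∀ A ∈ blocks, A.card = 5 := by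
  simp only [blocks, biplane, mem_image, forall_exists_index, and_imp]
  rintro _ _ t - rfl rfl
  rw [bstar, card_image_of_injective _ (Option.some_injective _),
    card_image_of_injective _ (add_left_injective t)]
  rfl

lemma card_points : points.card = 11 := by
  rw [points, card_image_of_injective _ fun a b h => Option.some_injective _ (singleton_injective h)]
  rfl

lemma card_of_mem_points : ∀ A ∈ points, A.card = 1 := by
  simp [points]

lemma card_of_mem_singleton_none : ∀ A ∈ ({{none}} : Finset (Finset X)), A.card = 1 := by
  simp

lemma notMem_withCompl_points {T : Finset X} (hT : T ∈ withCompl {{none}}) :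
    T ∉ withCompl points := by
  intro hT'
  obtain ⟨A, hA, h⟩ := mem_withCompl.1 hT
  obtain ⟨B, hB, h'⟩ := mem_withCompl.1 hT'
  have hA1 := card_of_mem_singleton_none A hA
  have hB1 := card_of_mem_points B hB
  have hne : A ≠ B := by
    rintro rfl
    obtain ⟨k, -, rfl⟩ := mem_image.1 hB
    simp at hA
  have hA2 := card_compl_X A
  have hB2 := card_compl_X B
  rcases h with rfl | rfl <;> rcases h' with h' | h'
  · exact hne h'
  · rw [h'] at hA1; omega
  · rw [h'] at hA2; omega
  · exact hne (compl_injective h')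

open Classical in
lemma cP_eq (T : Finset X) :
    cP T = if T ∈ withCompl blocks then 1 else if T ∈ withCompl points then -3
      else if T ∈ withCompl {{none}} then -2 else 0 := by
  simp [cP, mem_withCompl, blocks, points]

lemma kK_mul_cP (T : Finset X) :
    kK T * cP T = (if T ∈ withCompl blocks then -2 else 0) +
      (if T ∈ withCompl points then 3 else 0) + (if T ∈ withCompl {{none}} then 2 else 0) := by
  have hb := @card_of_mem_withCompl _ _ card_of_mem_blocks T
  have hp := @card_of_mem_withCompl _ _ card_of_mem_points T
  have hn := @card_of_mem_withCompl _ _ card_of_mem_singleton_none T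
  have hnp := @notMem_withCompl_points T
  rw [cP_eq, kK]
  grind

/-- `K_{Mbar_{0,12}} · C_𝒫 = 13 ≥ 0`: the sum of `k(T)·c(T)` over all `T` with
`∅ ≠ T ≠ X` equals `26` (each unordered class is counted twice). -/
theorem K_dot_CP :
    ∑ T ∈ Finset.univ.filter (fun T : Finset X => T ≠ ∅ ∧ T ≠ Finset.univ),
      kK T * cP T = 26 := by
  simp only [kK_mul_cP, sum_add_distrib]
  rw [sum_withCompl card_of_mem_blocks (by norm_num) (by norm_num),
    sum_withCompl card_of_mem_points (by norm_num) (by norm_num),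
    sum_withCompl card_of_mem_singleton_none (by norm_num) (by norm_num),
    card_blocks, card_points, card_singleton]
  norm_num
end

section
/- The divisor D_𝒫 on Mbar_{0,12} is F-nef: for every partition of X = Option (ZMod 11) into four nonempty subsets A₁, A₂, A₃, A₄ (pairwise disjoint with union X), the intersection number of D_𝒫 with the F-curve C_{A₁A₂A₃A₄}, namely w(A₁∪A₂) + w(A₁∪A₃) + w(A₁∪A₄) − w(A₁) − w(A₂) − w(A₃) − w(A₄), is nonnegative. -/
open Finset

open Classical in
/-- The Kapranov coefficient function of the divisor `D_𝒫`. -/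
noncomputable def dP : Finset (ZMod 11) → ℤ := fun S =>
  if S.card = 0 then -5
  else if S.card = 1 then -4
  else if S.card = 2 then -3
  else if S.card = 3 then -2
  else if S.card = 4 then -1
  else if (S.card = 5 ∨ S.card = 6) ∧ (S ∈ biplane ∨ ∃ B ∈ biplane, Disjoint S B)
    then -1
  else 0

/-- Extension of a Kapranov coefficient function on `Finset (ZMod 11)` to all boundary
classes, indexed by subsets `T ⊆ X`. -/
noncomputable def extendCoeff (e : Finset (ZMod 11) → ℤ) : Finset X → ℤ := fun T =>
  if none ∈ T then e (Finset.univ.filter fun a : ZMod 11 => some a ∈ T)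
  else e (Finset.univ.filter fun a : ZMod 11 => some a ∉ T)

/-- The block `Q + t` of the biplane. -/
def block (t : ZMod 11) : Finset (ZMod 11) := Q.image (· + t)

lemma mem_biplane {B : Finset (ZMod 11)} : B ∈ biplane ↔ ∃ t, block t = B := by
  simp [biplane, block]

lemma mem_block {x t : ZMod 11} : x ∈ block t ↔ x - t ∈ Q := by
  simp [block, sub_eq_add_neg]

lemma card_block (t : ZMod 11) : (block t).card = 5 := by
  rw [block, card_image_of_injective _ (add_left_injective t)]
  rfl

lemma card_block_inter_block {t u : ZMod 11} (h : t ≠ u) :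
    (block t ∩ block u).card = 2 := by
  revert t u
  decide +kernel

lemma card_blocks_through_pair {x y : ZMod 11} (h : x ≠ y) :
    (univ.filter fun t => x ∈ block t ∧ y ∈ block t).card = 2 := by
  simp only [mem_block]
  revert x y
  decide +kernel

lemma card_univ_zmod : (univ : Finset (ZMod 11)).card = 11 := rfl

lemma card_add_card_block_le {P : Finset (ZMod 11)} {t : ZMod 11} (h : Disjoint P (block t)) :
    P.card + 5 ≤ 11 := by
  have hle := card_le_univ (P ∪ block t)
  rwa [card_union_of_disjoint h, card_block, ZMod.card] at hle

/-- The sets of size five or six at which `dP` takes the exceptional value `-1`. -/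
def IsSpecial (S : Finset (ZMod 11)) : Prop :=
  (S.card = 5 ∨ S.card = 6) ∧ ∃ t, S = block t ∨ Disjoint S (block t)

lemma isSpecial_compl_block (t : ZMod 11) : IsSpecial (block t)ᶜ := by
  refine ⟨Or.inr ?_, t, Or.inr disjoint_compl_left⟩
  rw [card_compl, card_block, ZMod.card]

lemma IsSpecial.compl_of_card_eq_six {S : Finset (ZMod 11)} (hS : IsSpecial S)
    (h6 : S.card = 6) : IsSpecial Sᶜ := by
  obtain ⟨-, t, rfl | h⟩ := hS
  · simp [card_block] at h6
  · have hc : Sᶜ.card = 5 := by rw [card_compl, h6, ZMod.card]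
    refine ⟨Or.inl hc, t, Or.inl (eq_of_subset_of_card_le ?_ ?_).symm⟩
    · exact subset_compl_iff_disjoint_left.2 h
    · rw [hc, card_block]

lemma IsSpecial.subset {S T : Finset (ZMod 11)} (hT : IsSpecial T) (hST : S ⊆ T)
    (hS : S.card = 5) : IsSpecial S := by
  obtain ⟨-, t, rfl | h⟩ := hT
  · exact ⟨Or.inl hS, t, Or.inl (eq_of_subset_of_card_le hST (by rw [hS, card_block]))⟩
  · exact ⟨Or.inl hS, t, Or.inr (h.mono_left hST)⟩

lemma card_inter_of_disjoint_blocks {P R : Finset (ZMod 11)} {t u : ZMod 11} (htu : t ≠ u)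
    (hP : Disjoint P (block t)) (hR : Disjoint R (block u)) :
    (P ∩ R).card ≤ 3 ∧ P.card + R.card ≤ (P ∩ R).card + 9 := by
  have h₁ := card_union_add_card_inter (block t) (block u)
  have h₂ := card_union_add_card_inter P R
  have h₃ : Disjoint (P ∩ R) (block t ∪ block u) :=
    disjoint_union_right.2 ⟨hP.mono_left inter_subset_left, hR.mono_left inter_subset_right⟩
  have h₄ : Disjoint (P ∪ R) (block t ∩ block u) :=
    disjoint_union_left.2 ⟨hP.mono_right inter_subset_left, hR.mono_right inter_subset_right⟩
  have h₅ := card_le_univ ((P ∩ R) ∪ (block t ∪ block u))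
  have h₆ := card_le_univ ((P ∪ R) ∪ (block t ∩ block u))
  rw [card_union_of_disjoint h₃, ZMod.card] at h₅
  rw [card_union_of_disjoint h₄, ZMod.card] at h₆
  rw [card_block_inter_block htu, card_block, card_block] at h₁
  rw [card_block_inter_block htu] at h₆
  omega

lemma card_inter_of_block_of_disjoint_block {R : Finset (ZMod 11)} {t u : ZMod 11}
    (htu : t ≠ u) (hR : Disjoint R (block u)) :
    (block t ∩ R).card ≤ 3 ∧ R.card ≤ (block t ∩ R).card + 3 := by
  have h₁ := card_sdiff_add_card_inter (block t) (block u)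
  have h₂ := card_sdiff_add_card_inter (block u) (block t)
  have h₃ : (block t ∩ R).card ≤ (block t \ block u).card := by
    refine card_le_card fun x hx => ?_
    rw [mem_inter] at hx
    exact mem_sdiff.2 ⟨hx.1, disjoint_left.1 hR hx.2⟩
  have h₄ : Disjoint (block t ∪ R) (block u \ block t) :=
    disjoint_union_left.2 ⟨disjoint_sdiff, hR.mono_right sdiff_subset⟩
  have h₅ := card_le_univ ((block t ∪ R) ∪ (block u \ block t))
  have h₆ := card_union_add_card_inter (block t) R
  rw [card_union_of_disjoint h₄, ZMod.card] at h₅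
  rw [card_block_inter_block htu, card_block] at h₁
  rw [card_block_inter_block htu.symm, card_block] at h₂
  rw [card_block] at h₆
  omega

/-- The possible positions of two special sets. -/
lemma IsSpecial.inter_cases {P R : Finset (ZMod 11)} (hP : IsSpecial P) (hR : IsSpecial R) :
    P = R ∨
    (P.card + R.card ≤ (P ∩ R).card + 6 ∧
      (P.card + R.card = (P ∩ R).card + 6 → IsSpecial (P ∪ R))) ∨
    ((P ∩ R).card ≤ 3 ∧ P.card + R.card ≤ (P ∩ R).card + 9) ∨
    ((P ∩ R).card = 0 ∧ (IsSpecial Pᶜ ∨ IsSpecial Rᶜ)) := by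
  obtain ⟨-, t, rfl | hP⟩ := hP <;> obtain ⟨-, u, rfl | hR⟩ := hR <;>
    rcases eq_or_ne t u with rfl | htu
  · exact Or.inl rfl
  · have := card_block_inter_block htu
    have := card_block t
    have := card_block u
    omega
  · exact Or.inr (Or.inr (Or.inr ⟨by rw [card_eq_zero, ← disjoint_iff_inter_eq_empty]
                                     exact hR.symm, Or.inl (isSpecial_compl_block t)⟩))
  · have := card_inter_of_block_of_disjoint_block htu hR
    have := card_block t
    omega
  · exact Or.inr (Or.inr (Or.inr ⟨by rwa [card_eq_zero, ← disjoint_iff_inter_eq_empty],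
      Or.inr (isSpecial_compl_block t)⟩))
  · have := card_inter_of_block_of_disjoint_block htu.symm hP
    rw [inter_comm] at this
    have := card_block u
    omega
  · have h := card_union_add_card_inter P R
    have hd := disjoint_union_left.2 ⟨hP, hR⟩
    have := card_add_card_block_le hd
    exact Or.inr (Or.inl ⟨by omega, fun h' => ⟨Or.inr (by omega), t, Or.inr hd⟩⟩)
  · exact Or.inr (Or.inr (Or.inl (card_inter_of_disjoint_blocks htu hP hR)))

/-- If two special six-sets cover the complement of a pair `A`, then `A` does not extend to
a special five-set by their intersection `S`. -/
lemma not_isSpecial_of_triple {S A B C : Finset (ZMod 11)}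
    (hSA : Disjoint S A) (hSB : Disjoint S B) (hSC : Disjoint S C)
    (hAB : Disjoint A B) (hAC : Disjoint A C) (hBC : Disjoint B C)
    (hU : S ∪ A ∪ B ∪ C = univ) (hS : S.card = 3) (hA : A.card = 2) (hB : B.card = 3)
    (hC : C.card = 3) (hB' : IsSpecial (S ∪ B)) (hC' : IsSpecial (S ∪ C)) :
    ¬ IsSpecial (S ∪ A) := by
  have eq_block {P R : Finset (ZMod 11)} {t : ZMod 11} (hP : Disjoint P (block t))
      (hPR : P ∪ R = univ) (hR : R.card = 5) : block t = R := by
    refine eq_of_subset_of_card_le (fun x hx => ?_) (by rw [hR, card_block])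
    have hx' : x ∈ P ∪ R := hPR ▸ mem_univ x
    exact (mem_union.1 hx').resolve_left (disjoint_right.1 hP hx)
  obtain ⟨-, u, hu | hu⟩ := hB'
  · have h := card_block u
    rw [← hu, card_union_of_disjoint hSB] at h
    omega
  obtain ⟨-, v, hv | hv⟩ := hC'
  · have h := card_block v
    rw [← hv, card_union_of_disjoint hSC] at h
    omega
  replace hu : block u = A ∪ C := eq_block hu
    (by rw [← hU]; ac_rfl)
    (by rw [card_union_of_disjoint hAC]; omega)
  replace hv : block v = A ∪ B := eq_block hv
    (by rw [← hU]; ac_rfl)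
    (by rw [card_union_of_disjoint hAB]; omega)
  obtain ⟨b, hb⟩ : B.Nonempty := card_pos.1 (by omega)
  obtain ⟨s, hs⟩ : S.Nonempty := card_pos.1 (by omega)
  obtain ⟨x, y, hxy, rfl⟩ := card_eq_two.1 hA
  rw [disjoint_left] at hSB hSC hSA hBC hAB
  have huv : u ≠ v := by
    rintro rfl
    have : b ∈ ({x, y} : Finset (ZMod 11)) ∪ C := hu ▸ hv ▸ mem_union_right _ hb
    exact (mem_union.1 this).elim (fun h => hAB h hb) (hBC hb)
  rintro ⟨-, t, ht | ht⟩
  · have hst : s ∈ block t := ht ▸ mem_union_left _ hs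
    have htu : t ≠ u := by
      rintro rfl
      rw [hu] at hst
      exact (mem_union.1 hst).elim (hSA hs) (hSC hs)
    have htv : t ≠ v := by
      rintro rfl
      rw [hv] at hst
      exact (mem_union.1 hst).elim (hSA hs) (hSB hs)
    have h₃ : ({t, u, v} : Finset (ZMod 11)).card = 3 :=
      card_eq_three.2 ⟨t, u, v, htu, htv, huv, rfl⟩
    have hle : ({t, u, v} : Finset (ZMod 11)).card ≤
        (univ.filter fun t => x ∈ block t ∧ y ∈ block t).card := by
      refine card_le_card fun z hz => ?_
      simp only [mem_insert, mem_singleton] at hz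
      rw [mem_filter]
      rcases hz with rfl | rfl | rfl
      · simp [← ht]
      · simp [hu]
      · simp [hv]
    rw [card_blocks_through_pair hxy] at hle
    omega
  · have hxt : x ∉ block t := disjoint_left.1 ht (by simp)
    have htu : t ≠ u := by
      rintro rfl
      exact hxt (by simp [hu])
    have htv : t ≠ v := by
      rintro rfl
      exact hxt (by simp [hv])
    have hsub : block t ⊆ (block t ∩ block u) ∪ (block t ∩ block v) := by
      intro z hz
      have hz' : z ∈ S ∪ {x, y} ∪ B ∪ C := hU ▸ mem_univ z
      have := disjoint_right.1 ht hz
      simp only [mem_union, mem_inter, hu, hv] at hz' this ⊢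
      grind
    have h := (card_le_card hsub).trans (card_union_le _ _)
    rw [card_block, card_block_inter_block htu, card_block_inter_block htv] at h
    omega

open Classical in
/-- The indicator function of the special sets. -/
noncomputable def specialIndicator (S : Finset (ZMod 11)) : ℕ := if IsSpecial S then 1 else 0

lemma specialIndicator_eq_one {S : Finset (ZMod 11)} :
    specialIndicator S = 1 ↔ IsSpecial S := by
  simp [specialIndicator]

lemma specialIndicator_cases (S : Finset (ZMod 11)) : specialIndicator S = 0 ∨
    specialIndicator S = 1 ∧ (S.card = 5 ∨ S.card = 6) := by
  by_cases h : IsSpecial S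
  · exact Or.inr ⟨specialIndicator_eq_one.2 h, h.1⟩
  · simp [specialIndicator, h]

lemma dP_eq (S : Finset (ZMod 11)) :
    dP S = -((5 - S.card : ℕ) : ℤ) - specialIndicator S := by
  have h : (S ∈ biplane ∨ ∃ B ∈ biplane, Disjoint S B) ↔
      ∃ t, S = block t ∨ Disjoint S (block t) := by
    rw [exists_or]
    simp [mem_biplane, eq_comm]
  simp only [dP, specialIndicator, IsSpecial, h]
  by_cases h' : ∃ t, S = block t ∨ Disjoint S (block t) <;>
    simp only [h', and_true, and_false, if_false] <;> split_ifs <;> omega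

lemma specialIndicator_pair {S A B C : Finset (ZMod 11)}
    (hSA : Disjoint S A) (hSB : Disjoint S B) (hSC : Disjoint S C)
    (hAB : Disjoint A B) (hAC : Disjoint A C) (hBC : Disjoint B C)
    (hU : S ∪ A ∪ B ∪ C = univ) (hA : A.Nonempty)
    (hx : specialIndicator (S ∪ A) = 1) (hy : specialIndicator (S ∪ B) = 1) :
    (S.card + A.card + B.card ≤ 6 ∧
      (S.card + A.card + B.card = 6 → specialIndicator (S ∪ A ∪ B) = 1)) ∨
    (S.card ≤ 3 ∧ S.card + A.card + B.card ≤ 9) ∨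
    (S.card = 0 ∧ (specialIndicator (S ∪ B ∪ C) = 1 ∨ specialIndicator (S ∪ A ∪ C) = 1)) := by
  simp only [specialIndicator_eq_one] at *
  have hI : (S ∪ A) ∩ (S ∪ B) = S := by
    rw [← union_inter_distrib_left, disjoint_iff_inter_eq_empty.1 hAB, union_empty]
  have h := hx.inter_cases hy
  rw [hI, card_union_of_disjoint hSA, card_union_of_disjoint hSB] at h
  rcases h with h | ⟨h₁, h₂⟩ | h | ⟨h₁, h₂⟩
  · obtain ⟨a, ha⟩ := hA
    have : a ∈ S ∪ B := h ▸ mem_union_right _ ha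
    exact ((mem_union.1 this).elim (disjoint_right.1 hSA ha) (disjoint_left.1 hAB ha)).elim
  · refine Or.inl ⟨by omega, fun h => ?_⟩
    have := h₂ (by omega)
    rwa [← union_union_distrib_left, ← union_assoc] at this
  · exact Or.inr (Or.inl ⟨h.1, by omega⟩)
  · refine Or.inr (Or.inr ⟨h₁, ?_⟩)
    have compl_eq {P R : Finset (ZMod 11)} (hPR : Disjoint P R) (h : P ∪ R = univ) : Pᶜ = R :=
      (IsCompl.of_eq (disjoint_iff.1 hPR) h).compl_eq
    obtain rfl := card_eq_zero.1 h₁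
    simp only [empty_union] at h₂ hU ⊢
    rwa [compl_eq (R := B ∪ C) (disjoint_union_right.2 ⟨hAB, hAC⟩) (by rw [← hU, union_assoc]),
      compl_eq (R := A ∪ C) (disjoint_union_right.2 ⟨hAB.symm, hBC⟩)
        (by rw [← hU]; ac_rfl)] at h₂

lemma specialIndicator_single {S A B C : Finset (ZMod 11)}
    (hSA : Disjoint S A) (hAB : Disjoint A B) (hAC : Disjoint A C)
    (hU : S ∪ A ∪ B ∪ C = univ) (hx : specialIndicator (S ∪ A) = 1) :
    (S.card = 5 → specialIndicator S = 1) ∧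
    (S.card = 0 → A.card = 6 → specialIndicator (S ∪ B ∪ C) = 1) := by
  simp only [specialIndicator_eq_one] at *
  refine ⟨hx.subset subset_union_left, fun h₀ h₆ => ?_⟩
  obtain rfl := card_eq_zero.1 h₀
  simp only [empty_union] at *
  have := hx.compl_of_card_eq_six h₆
  rwa [(IsCompl.of_eq (disjoint_iff.1 (disjoint_union_right.2 ⟨hAB, hAC⟩))
    ((union_assoc A B C).symm.trans hU)).compl_eq] at this

/-! The numerical inequalities, according to how many of `S ∪ A`, `S ∪ B`, `S ∪ C` are special. -/

lemma truncated_F_inequality_of_no_special {s a b c : ℕ} (hn : s + a + b + c = 11)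
    (ha : 0 < a) (hb : 0 < b) (hc : 0 < c) :
    (5 - (s + a)) + (5 - (s + b)) + (5 - (s + c)) ≤
      (5 - s) + (5 - (s + a + b)) + (5 - (s + a + c)) + (5 - (s + b + c)) := by
  omega

lemma truncated_F_inequality_of_one_special {s a b c u r : ℕ} (hn : s + a + b + c = 11)
    (ha : 0 < a) (hb : 0 < b) (hc : 0 < c) (hx : s + a = 5 ∨ s + a = 6)
    (hu : s = 5 → u = 1) (hr : s = 0 → a = 6 → r = 1) :
    (5 - (s + a)) + (5 - (s + b)) + (5 - (s + c)) + 1 ≤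
      (5 - s) + (5 - (s + a + b)) + (5 - (s + a + c)) + (5 - (s + b + c)) + u + r := by
  omega

lemma truncated_F_inequality_of_two_special {s a b c u p q r : ℕ} (hn : s + a + b + c = 11)
    (ha : 0 < a) (hb : 0 < b) (hc : 0 < c) (hx : s + a = 5 ∨ s + a = 6)
    (hy : s + b = 5 ∨ s + b = 6)
    (hxy : (s + a + b ≤ 6 ∧ (s + a + b = 6 → p = 1)) ∨
      (s ≤ 3 ∧ s + a + b ≤ 9) ∨ (s = 0 ∧ (r = 1 ∨ q = 1))) :
    (5 - (s + a)) + (5 - (s + b)) + (5 - (s + c)) + 2 ≤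
      (5 - s) + (5 - (s + a + b)) + (5 - (s + a + c)) + (5 - (s + b + c)) + u + p + q + r := by
  omega

lemma truncated_F_inequality_of_three_special {s a b c u p q r : ℕ} (hn : s + a + b + c = 11)
    (ha : 0 < a) (hb : 0 < b) (hc : 0 < c) (hx : s + a = 5 ∨ s + a = 6)
    (hy : s + b = 5 ∨ s + b = 6) (hz : s + c = 5 ∨ s + c = 6)
    (tx : ¬ (s = 3 ∧ a = 2 ∧ b = 3 ∧ c = 3))
    (ty : ¬ (s = 3 ∧ b = 2 ∧ a = 3 ∧ c = 3))
    (tz : ¬ (s = 3 ∧ c = 2 ∧ a = 3 ∧ b = 3)) :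
    (5 - (s + a)) + (5 - (s + b)) + (5 - (s + c)) + 3 ≤
      (5 - s) + (5 - (s + a + b)) + (5 - (s + a + c)) + (5 - (s + b + c)) + u + p + q + r := by
  obtain rfl : s = 2 := by rcases hx with hx | hx <;> rcases hy with hy | hy <;> omega
  obtain ⟨rfl, rfl, rfl⟩ : a = 3 ∧ b = 3 ∧ c = 3 := by omega
  omega

/-- The F-curve inequalities in Kapranov coordinates. -/
lemma dP_F_inequality {S A B C : Finset (ZMod 11)}
    (hSA : Disjoint S A) (hSB : Disjoint S B) (hSC : Disjoint S C)
    (hAB : Disjoint A B) (hAC : Disjoint A C) (hBC : Disjoint B C)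
    (hU : S ∪ A ∪ B ∪ C = univ) (hA : A.Nonempty) (hB : B.Nonempty) (hC : C.Nonempty) :
    0 ≤ dP (S ∪ A) + dP (S ∪ B) + dP (S ∪ C) - dP S - dP (S ∪ A ∪ B) - dP (S ∪ A ∪ C)
      - dP (S ∪ B ∪ C) := by
  have hSAB := disjoint_union_left.2 ⟨hSB, hAB⟩
  have hSAC := disjoint_union_left.2 ⟨hSC, hAC⟩
  have hSBC := disjoint_union_left.2 ⟨hSC, hBC⟩
  have hn : S.card + A.card + B.card + C.card = 11 := by
    rw [← card_union_of_disjoint hSA, ← card_union_of_disjoint hSAB,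
      ← card_union_of_disjoint (disjoint_union_left.2 ⟨hSAC, hBC⟩), hU, card_univ_zmod]
  have hACB : S ∪ A ∪ C ∪ B = univ := by rw [← hU, union_right_comm]
  have hBAC : S ∪ B ∪ A ∪ C = univ := by rw [← hU, union_right_comm S]
  have hBCA : S ∪ B ∪ C ∪ A = univ := by rw [← hBAC, union_right_comm]
  have hCAB : S ∪ C ∪ A ∪ B = univ := by rw [← hACB, union_right_comm S]
  have pAB := specialIndicator_pair hSA hSB hSC hAB hAC hBC hU hA
  have pAC := specialIndicator_pair hSA hSC hSB hAC hAB hBC.symm hACB hA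
  have pBC := specialIndicator_pair hSB hSC hSA hBC hAB.symm hAC.symm hBCA hB
  have qA := specialIndicator_single hSA hAB hAC hU
  have qB := specialIndicator_single hSB hAB.symm hBC hBAC
  have qC := specialIndicator_single hSC hAC.symm hBC.symm hCAB
  have tA := not_isSpecial_of_triple hSA hSB hSC hAB hAC hBC hU
  have tB := not_isSpecial_of_triple hSB hSA hSC hAB.symm hBC hAC hBAC
  have tC := not_isSpecial_of_triple hSC hSA hSB hAC.symm hBC.symm hAB hCAB
  rw [union_right_comm S C B] at pAC
  rw [union_right_comm S B A, union_right_comm S C A] at pBC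
  have cA := specialIndicator_cases (S ∪ A)
  have cB := specialIndicator_cases (S ∪ B)
  have cC := specialIndicator_cases (S ∪ C)
  simp only [card_union_of_disjoint hSA, card_union_of_disjoint hSB,
    card_union_of_disjoint hSC] at cA cB cC
  replace hA := hA.card_pos
  replace hB := hB.card_pos
  replace hC := hC.card_pos
  have swap := add_right_comm S.card
  simp only [dP_eq, card_union_of_disjoint hSAB, card_union_of_disjoint hSAC,
    card_union_of_disjoint hSBC, card_union_of_disjoint hSA, card_union_of_disjoint hSB,
    card_union_of_disjoint hSC]
  rcases cA with cA | ⟨cA, cA'⟩ <;> rcases cB with cB | ⟨cB, cB'⟩ <;>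
    rcases cC with cC | ⟨cC, cC'⟩
  · have := truncated_F_inequality_of_no_special hn hA hB hC
    omega
  · have := truncated_F_inequality_of_one_special (by omega) hC hA hB cC' (qC cC).1 (qC cC).2
    rw [swap C.card A.card, swap C.card B.card] at this
    omega
  · have := truncated_F_inequality_of_one_special (by omega) hB hA hC cB' (qB cB).1 (qB cB).2
    rw [swap B.card A.card] at this
    omega
  · have := truncated_F_inequality_of_two_special (u := specialIndicator S) (by omega) hB hC hA
      cB' cC' (pBC cB cC)
    rw [swap B.card A.card, swap C.card A.card] at this
    omega
  · have := truncated_F_inequality_of_one_special hn hA hB hC cA' (qA cA).1 (qA cA).2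
    omega
  · have := truncated_F_inequality_of_two_special (u := specialIndicator S) (by omega) hA hC hB
      cA' cC' (pAC cA cC)
    rw [swap C.card B.card] at this
    omega
  · have := truncated_F_inequality_of_two_special (u := specialIndicator S) hn hA hB hC
      cA' cB' (pAB cA cB)
    omega
  · have := truncated_F_inequality_of_three_special (u := specialIndicator S)
      (p := specialIndicator (S ∪ A ∪ B)) (q := specialIndicator (S ∪ A ∪ C))
      (r := specialIndicator (S ∪ B ∪ C)) hn hA hB hC cA' cB' cC'
      (fun ⟨h, h₁, h₂, h₃⟩ => tA h h₁ h₂ h₃ (specialIndicator_eq_one.1 cB)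
        (specialIndicator_eq_one.1 cC) (specialIndicator_eq_one.1 cA))
      (fun ⟨h, h₁, h₂, h₃⟩ => tB h h₁ h₂ h₃ (specialIndicator_eq_one.1 cA)
        (specialIndicator_eq_one.1 cC) (specialIndicator_eq_one.1 cB))
      (fun ⟨h, h₁, h₂, h₃⟩ => tC h h₁ h₂ h₃ (specialIndicator_eq_one.1 cA)
        (specialIndicator_eq_one.1 cB) (specialIndicator_eq_one.1 cC))
    omega

lemma extendCoeff_compl (e : Finset (ZMod 11) → ℤ) (T : Finset X) :
    extendCoeff e Tᶜ = extendCoeff e T := by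
  by_cases h : none ∈ T <;> simp [extendCoeff, h]

lemma extendCoeff_dP_F_nef_of_none_mem {A B C D : Finset X}
    (hA : A.Nonempty) (hB : B.Nonempty) (hC : C.Nonempty)
    (hAB : Disjoint A B) (hAC : Disjoint A C) (hAD : Disjoint A D)
    (hBC : Disjoint B C) (hBD : Disjoint B D) (hCD : Disjoint C D)
    (hU : A ∪ B ∪ C ∪ D = univ) (hD : none ∈ D) :
    0 ≤ extendCoeff dP (A ∪ B) + extendCoeff dP (A ∪ C) + extendCoeff dP (A ∪ D)
        - extendCoeff dP A - extendCoeff dP B - extendCoeff dP C - extendCoeff dP D := by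
  have hA' := disjoint_right.1 hAD hD
  have hB' := disjoint_right.1 hBD hD
  have hC' := disjoint_right.1 hCD hD
  let p (T : Finset X) : Finset (ZMod 11) := univ.filter fun a => some a ∈ T
  have hp {T U : Finset X} (h : Disjoint T U) : Disjoint (p T) (p U) :=
    disjoint_filter.2 fun a _ ha => disjoint_left.1 h ha
  have hp' {T : Finset X} (hT : T.Nonempty) (h : none ∉ T) : (p T).Nonempty := by
    obtain ⟨_ | a, ha⟩ := hT
    · exact absurd ha h
    · exact ⟨a, by simpa [p] using ha⟩
  have mem (a : ZMod 11) : some a ∈ A ∪ B ∪ C ∪ D := hU ▸ mem_univ _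
  have key := dP_F_inequality (hp hAD.symm) (hp hBD.symm) (hp hCD.symm) (hp hAB) (hp hAC)
    (hp hBC) (by ext a; have := mem a; simp [p] at this ⊢; grind)
    (hp' hA hA') (hp' hB hB') (hp' hC hC')
  have out {T U : Finset X} (hT : none ∉ T) (h : ∀ a : ZMod 11, some a ∉ T ↔ some a ∈ U) :
      extendCoeff dP T = dP (p U) := by
    simp only [extendCoeff, if_neg hT, h, p]
  have union (T U : Finset X) : p T ∪ p U = p (T ∪ U) := by ext; simp [p]
  rw [disjoint_left] at hAB hAC hAD hBC hBD hCD
  have e₁ : extendCoeff dP (A ∪ B) = dP (p D ∪ p C) := by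
    rw [union]
    refine out (by simp [hA', hB']) fun a => ?_
    have := mem a
    have := @hAC (some a); have := @hAD (some a); have := @hBC (some a); have := @hBD (some a)
    simp only [mem_union] at *
    grind
  have e₂ : extendCoeff dP (A ∪ C) = dP (p D ∪ p B) := by
    rw [union]
    refine out (by simp [hA', hC']) fun a => ?_
    have := mem a
    have := @hAB (some a); have := @hAD (some a); have := @hBC (some a); have := @hCD (some a)
    simp only [mem_union] at *
    grind
  have e₃ : extendCoeff dP (A ∪ D) = dP (p D ∪ p A) := by
    rw [union, extendCoeff, if_pos (mem_union_right _ hD), union_comm]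
  have e₄ : extendCoeff dP A = dP (p D ∪ p B ∪ p C) := by
    rw [union, union]
    refine out hA' fun a => ?_
    have := mem a
    have := @hAB (some a); have := @hAC (some a); have := @hAD (some a)
    simp only [mem_union] at *
    grind
  have e₅ : extendCoeff dP B = dP (p D ∪ p A ∪ p C) := by
    rw [union, union]
    refine out hB' fun a => ?_
    have := mem a
    have := @hAB (some a); have := @hBC (some a); have := @hBD (some a)
    simp only [mem_union] at *
    grind
  have e₆ : extendCoeff dP C = dP (p D ∪ p A ∪ p B) := by
    rw [union, union]
    refine out hC' fun a => ?_
    have := mem a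
    have := @hAC (some a); have := @hBC (some a); have := @hCD (some a)
    simp only [mem_union] at *
    grind
  have e₇ : extendCoeff dP D = dP (p D) := by rw [extendCoeff, if_pos hD]
  rw [e₁, e₂, e₃, e₄, e₅, e₆, e₇]
  linarith

/-- `D_𝒫` is F-nef: it pairs nonnegatively with every F-curve `C_{A₁A₂A₃A₄}`. -/
theorem DP_F_nef (A₁ A₂ A₃ A₄ : Finset X)
    (h₁ : A₁.Nonempty) (h₂ : A₂.Nonempty) (h₃ : A₃.Nonempty) (h₄ : A₄.Nonempty)
    (h₁₂ : Disjoint A₁ A₂) (h₁₃ : Disjoint A₁ A₃) (h₁₄ : Disjoint A₁ A₄)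
    (h₂₃ : Disjoint A₂ A₃) (h₂₄ : Disjoint A₂ A₄) (h₃₄ : Disjoint A₃ A₄)
    (hU : A₁ ∪ A₂ ∪ A₃ ∪ A₄ = Finset.univ) :
    0 ≤ extendCoeff dP (A₁ ∪ A₂) + extendCoeff dP (A₁ ∪ A₃) + extendCoeff dP (A₁ ∪ A₄)
        - extendCoeff dP A₁ - extendCoeff dP A₂ - extendCoeff dP A₃
        - extendCoeff dP A₄ := by
  have w_eq {P R : Finset X} (h : Disjoint P R) (h' : P ∪ R = univ) :
      extendCoeff dP R = extendCoeff dP P := by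
    rw [← (IsCompl.of_eq (disjoint_iff.1 h) h').compl_eq, extendCoeff_compl]
  have e₁₂ : extendCoeff dP (A₃ ∪ A₄) = extendCoeff dP (A₁ ∪ A₂) :=
    w_eq (by simp only [disjoint_union_left, disjoint_union_right]; exact
        ⟨⟨h₁₃, h₂₃⟩, h₁₄, h₂₄⟩)
      (by rw [← hU]; ac_rfl)
  have e₁₃ : extendCoeff dP (A₂ ∪ A₄) = extendCoeff dP (A₁ ∪ A₃) :=
    w_eq (by simp only [disjoint_union_left, disjoint_union_right]; exact
        ⟨⟨h₁₂, h₂₃.symm⟩, h₁₄, h₃₄⟩)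
      (by rw [← hU]; ac_rfl)
  have e₁₄ : extendCoeff dP (A₂ ∪ A₃) = extendCoeff dP (A₁ ∪ A₄) :=
    w_eq (by simp only [disjoint_union_left, disjoint_union_right]; exact
        ⟨⟨h₁₂, h₂₄.symm⟩, h₁₃, h₃₄.symm⟩)
      (by rw [← hU]; ac_rfl)
  have hnone : (none : X) ∈ A₁ ∪ A₂ ∪ A₃ ∪ A₄ := hU ▸ mem_univ _
  simp only [mem_union, or_assoc] at hnone
  rcases hnone with h | h | h | h
  · have := extendCoeff_dP_F_nef_of_none_mem h₂ h₃ h₄ h₂₃ h₂₄ h₁₂.symm h₃₄ h₁₃.symm h₁₄.symm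
      (by rw [← hU]; ac_rfl) h
    rw [union_comm A₂ A₁] at this
    linarith
  · have := extendCoeff_dP_F_nef_of_none_mem h₁ h₃ h₄ h₁₃ h₁₄ h₁₂ h₃₄ h₂₃.symm h₂₄.symm
      (by rw [← hU]; ac_rfl) h
    linarith
  · have := extendCoeff_dP_F_nef_of_none_mem h₁ h₂ h₄ h₁₂ h₁₄ h₁₃ h₂₄ h₂₃ h₃₄.symm
      (by rw [← hU]; ac_rfl) h
    linarith
  · exact extendCoeff_dP_F_nef_of_none_mem h₁ h₂ h₃ h₁₂ h₁₃ h₁₄ h₂₃ h₂₄ h₃₄ hU h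
end
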